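/- arXiv:2511.17243 — 2 statements merged into one kernel-verified Lean document; each statement's English description precedes it below -/
import Mathlib

section
/- If (A,B) is controllable and (A,C) is observable, then the discrete-time algebraic Riccati equation P = AᵀPA − AᵀPB(R + BᵀPB)⁻¹BᵀPA + CᵀC with R ≻ 0 has a unique positive definite solution P. -/
open Matrix

namespace Riccati

open Filter Topology

variable {n m p : ℕ}

/-- The quadratic form `v ↦ vᵀ M v` of a square matrix. -/
def quad {k : ℕ} (M : Matrix (Fin k) (Fin k) ℝ) (v : Fin k → ℝ) : ℝ := v ⬝ᵥ (M *ᵥ v)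

/-- The Riccati operator, whose fixed points are the solutions of the Riccati equation. -/
noncomputable def step (A : Matrix (Fin n) (Fin n) ℝ) (B : Matrix (Fin n) (Fin m) ℝ)
    (C : Matrix (Fin p) (Fin n) ℝ) (R : Matrix (Fin m) (Fin m) ℝ)
    (P : Matrix (Fin n) (Fin n) ℝ) : Matrix (Fin n) (Fin n) ℝ :=
  Aᵀ * P * A - Aᵀ * P * B * (R + Bᵀ * P * B)⁻¹ * Bᵀ * P * A + Cᵀ * C

lemma quad_nonneg {M : Matrix (Fin n) (Fin n) ℝ} (hM : M.PosSemidef) (v : Fin n → ℝ) :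
    0 ≤ quad M v := by
  simpa [quad] using hM.dotProduct_mulVec_nonneg v

lemma quad_pos {M : Matrix (Fin n) (Fin n) ℝ} (hM : M.PosDef) {v : Fin n → ℝ} (hv : v ≠ 0) :
    0 < quad M v := by
  simpa [quad] using hM.dotProduct_mulVec_pos hv

lemma eq_zero_of_quad_eq_zero {M : Matrix (Fin n) (Fin n) ℝ} (hM : M.PosDef) {v : Fin n → ℝ}
    (hv : quad M v = 0) : v = 0 := by
  by_contra h
  exact (quad_pos hM h).ne' hv

lemma quad_zero (M : Matrix (Fin n) (Fin n) ℝ) : quad M 0 = 0 := by simp [quad]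

lemma quad_smul (M : Matrix (Fin n) (Fin n) ℝ) (c : ℝ) (v : Fin n → ℝ) :
    quad M (c • v) = c ^ 2 * quad M v := by
  simp [quad, mulVec_smul]
  ring

lemma continuous_quad (M : Matrix (Fin n) (Fin n) ℝ) : Continuous (quad M) := by
  unfold quad
  fun_prop

lemma dotProduct_mulVec_comm {M : Matrix (Fin n) (Fin n) ℝ} (hM : Mᵀ = M) (v w : Fin n → ℝ) :
    v ⬝ᵥ (M *ᵥ w) = w ⬝ᵥ (M *ᵥ v) := by
  rw [dotProduct_mulVec, ← mulVec_transpose, hM, dotProduct_comm]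

lemma quad_add {M : Matrix (Fin n) (Fin n) ℝ} (hM : Mᵀ = M) (v w : Fin n → ℝ) :
    quad M (v + w) = quad M v + 2 * (v ⬝ᵥ (M *ᵥ w)) + quad M w := by
  simp only [quad, mulVec_add, dotProduct_add, add_dotProduct]
  rw [dotProduct_mulVec_comm hM w v]
  ring

lemma apply_eq_quad {M : Matrix (Fin n) (Fin n) ℝ} (hM : Mᵀ = M) (i j : Fin n) :
    M i j = (quad M (Pi.single i 1 + Pi.single j 1) - quad M (Pi.single i 1)
      - quad M (Pi.single j 1)) / 2 := by
  rw [quad_add hM]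
  simp
  ring

lemma transpose_eq {M : Matrix (Fin n) (Fin n) ℝ} (hM : M.PosSemidef) : Mᵀ = M := by
  simpa [IsHermitian] using hM.isHermitian

lemma posDef_weight {R : Matrix (Fin m) (Fin m) ℝ} (hR : R.PosDef) (B : Matrix (Fin n) (Fin m) ℝ)
    {P : Matrix (Fin n) (Fin n) ℝ} (hP : P.PosSemidef) : (R + Bᵀ * P * B).PosDef :=
  hR.add_posSemidef (by simpa using hP.conjTranspose_mul_mul_same B)

section Step

variable (A : Matrix (Fin n) (Fin n) ℝ) (B : Matrix (Fin n) (Fin m) ℝ)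
  (C : Matrix (Fin p) (Fin n) ℝ) {R : Matrix (Fin m) (Fin m) ℝ} {P : Matrix (Fin n) (Fin n) ℝ}

/-- Completion of squares for the one-step cost. -/
lemma quad_step_add (hR : R.PosDef) (hP : P.PosSemidef) (v : Fin n → ℝ) (u : Fin m → ℝ) :
    quad (step A B C R P) v
      + quad (R + Bᵀ * P * B) (u + (R + Bᵀ * P * B)⁻¹ *ᵥ (Bᵀ *ᵥ (P *ᵥ (A *ᵥ v))))
      = quad P (A *ᵥ v + B *ᵥ u) + quad R u + (C *ᵥ v) ⬝ᵥ (C *ᵥ v) := by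
  have hS := posDef_weight hR B hP
  have hPt := transpose_eq hP
  have hSt := transpose_eq hS.posSemidef
  have hdet : IsUnit (R + Bᵀ * P * B).det := (Matrix.isUnit_iff_isUnit_det _).1 hS.isUnit
  have hquad : quad (step A B C R P) v = quad P (A *ᵥ v)
      - (Bᵀ *ᵥ (P *ᵥ (A *ᵥ v))) ⬝ᵥ ((R + Bᵀ * P * B)⁻¹ *ᵥ (Bᵀ *ᵥ (P *ᵥ (A *ᵥ v))))
      + (C *ᵥ v) ⬝ᵥ (C *ᵥ v) := by
    simp only [quad, step, add_mulVec, sub_mulVec, ← mulVec_mulVec, dotProduct_add, dotProduct_sub]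
    congr 1
    · congr 1
      · rw [dotProduct_mulVec, vecMul_transpose]
      · rw [dotProduct_mulVec, vecMul_transpose, dotProduct_mulVec, ← mulVec_transpose, hPt,
          dotProduct_mulVec, ← mulVec_transpose]
    · rw [dotProduct_mulVec, vecMul_transpose]
  have hRB : quad (R + Bᵀ * P * B) u = quad R u + quad P (B *ᵥ u) := by
    simp only [quad, add_mulVec, dotProduct_add, ← mulVec_mulVec]
    rw [dotProduct_mulVec u Bᵀ, vecMul_transpose]
  have hcross : (A *ᵥ v) ⬝ᵥ (P *ᵥ (B *ᵥ u)) = u ⬝ᵥ (Bᵀ *ᵥ (P *ᵥ (A *ᵥ v))) := by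
    rw [dotProduct_mulVec_comm hPt, dotProduct_mulVec u Bᵀ, vecMul_transpose]
  rw [hquad, quad_add hSt, quad_add hPt, hRB, hcross]
  generalize Bᵀ *ᵥ (P *ᵥ (A *ᵥ v)) = w
  have hinv : (R + Bᵀ * P * B) *ᵥ ((R + Bᵀ * P * B)⁻¹ *ᵥ w) = w := by
    rw [mulVec_mulVec, mul_nonsing_inv _ hdet, one_mulVec]
  rw [hinv]
  have : quad (R + Bᵀ * P * B) ((R + Bᵀ * P * B)⁻¹ *ᵥ w)
      = w ⬝ᵥ ((R + Bᵀ * P * B)⁻¹ *ᵥ w) := by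
    rw [quad, hinv, dotProduct_comm]
  rw [this]
  ring

lemma quad_step_le (hR : R.PosDef) (hP : P.PosSemidef) (v : Fin n → ℝ) (u : Fin m → ℝ) :
    quad (step A B C R P) v
      ≤ quad P (A *ᵥ v + B *ᵥ u) + quad R u + (C *ᵥ v) ⬝ᵥ (C *ᵥ v) := by
  rw [← quad_step_add A B C hR hP v u]
  linarith [quad_nonneg (posDef_weight hR B hP).posSemidef
    (u + (R + Bᵀ * P * B)⁻¹ *ᵥ (Bᵀ *ᵥ (P *ᵥ (A *ᵥ v))))]

lemma exists_quad_step_eq (hR : R.PosDef) (hP : P.PosSemidef) (v : Fin n → ℝ) :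
    ∃ u, quad (step A B C R P) v
      = quad P (A *ᵥ v + B *ᵥ u) + quad R u + (C *ᵥ v) ⬝ᵥ (C *ᵥ v) := by
  refine ⟨-((R + Bᵀ * P * B)⁻¹ *ᵥ (Bᵀ *ᵥ (P *ᵥ (A *ᵥ v)))), ?_⟩
  rw [← quad_step_add A B C hR hP v, neg_add_cancel, quad_zero, add_zero]

lemma real_dotProduct_self_nonneg (w : Fin p → ℝ) : 0 ≤ w ⬝ᵥ w := by
  simpa using dotProduct_star_self_nonneg w

lemma posSemidef_step (hR : R.PosDef) (hP : P.PosSemidef) : (step A B C R P).PosSemidef := by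
  have hPt := transpose_eq hP
  have hRt := transpose_eq hR.posSemidef
  refine PosSemidef.of_dotProduct_mulVec_nonneg ?_ fun v => ?_
  · simp only [IsHermitian, step, conjTranspose_eq_transpose_of_trivial, transpose_add,
      transpose_sub, transpose_mul, transpose_transpose, hPt, hRt, transpose_nonsing_inv,
      Matrix.mul_assoc]
  · obtain ⟨u, hu⟩ := exists_quad_step_eq A B C hR hP v
    have : 0 ≤ quad (step A B C R P) v := by
      rw [hu]
      have := quad_nonneg hP (A *ᵥ v + B *ᵥ u)
      have := quad_nonneg hR.posSemidef u
      have := real_dotProduct_self_nonneg (C *ᵥ v)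
      positivity
    simpa [quad] using this

lemma quad_step_mono (hR : R.PosDef) (hP : P.PosSemidef) {Q : Matrix (Fin n) (Fin n) ℝ}
    (hQ : Q.PosSemidef) (h : ∀ v, quad P v ≤ quad Q v) (v : Fin n → ℝ) :
    quad (step A B C R P) v ≤ quad (step A B C R Q) v := by
  obtain ⟨u, hu⟩ := exists_quad_step_eq A B C hR hQ v
  rw [hu]
  linarith [quad_step_le A B C hR hP v u, h (A *ᵥ v + B *ᵥ u)]

lemma continuousAt_step (hR : R.PosDef) (hP : P.PosSemidef) : ContinuousAt (step A B C R) P := by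
  have hdet : (R + Bᵀ * P * B).det ≠ 0 := (posDef_weight hR B hP).det_pos.ne'
  have hS : Continuous fun X : Matrix (Fin n) (Fin n) ℝ => R + Bᵀ * X * B := by fun_prop
  have hinv : ContinuousAt (fun X : Matrix (Fin n) (Fin n) ℝ => (R + Bᵀ * X * B)⁻¹) P := by
    simp only [Matrix.inv_def, Ring.inverse_eq_inv']
    exact (hS.matrix_det.continuousAt.inv₀ hdet).smul hS.matrix_adjugate.continuousAt
  have hg : Continuous fun X : Matrix (Fin n) (Fin n) ℝ × Matrix (Fin m) (Fin m) ℝ =>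
      Aᵀ * X.1 * A - Aᵀ * X.1 * B * X.2 * Bᵀ * X.1 * A + Cᵀ * C := by fun_prop
  exact ContinuousAt.comp (f := fun X => (X, (R + Bᵀ * X * B)⁻¹)) hg.continuousAt
    (continuousAt_id.prodMk hinv)

end Step

lemma eq_zero_of_invariant {A : Matrix (Fin n) (Fin n) ℝ} {C : Matrix (Fin p) (Fin n) ℝ}
    (hObs : ∀ v : Fin n → ℝ, (∀ k < n, C *ᵥ ((A ^ k) *ᵥ v) = 0) → v = 0)
    (Z : (Fin n → ℝ) → Prop) (hZ : ∀ v, Z v → C *ᵥ v = 0 ∧ Z (A *ᵥ v))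
    {v : Fin n → ℝ} (hv : Z v) : v = 0 := by
  have h : ∀ k, Z ((A ^ k) *ᵥ v) := by
    intro k
    induction k with
    | zero => simpa using hv
    | succ k ih =>
      rw [pow_succ', ← mulVec_mulVec]
      exact (hZ _ ih).2
  exact hObs v fun k _ => (hZ _ (h k)).1

lemma posDef_of_step_eq {A : Matrix (Fin n) (Fin n) ℝ} {B : Matrix (Fin n) (Fin m) ℝ}
    {C : Matrix (Fin p) (Fin n) ℝ} {R : Matrix (Fin m) (Fin m) ℝ} (hR : R.PosDef)
    (hObs : ∀ v : Fin n → ℝ, (∀ k < n, C *ᵥ ((A ^ k) *ᵥ v) = 0) → v = 0)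
    {P : Matrix (Fin n) (Fin n) ℝ} (hP : P.PosSemidef) (hfix : step A B C R P = P) :
    P.PosDef := by
  refine PosDef.of_dotProduct_mulVec_pos hP.isHermitian fun v hv => ?_
  suffices 0 < quad P v by simpa [quad] using this
  refine lt_of_le_of_ne (quad_nonneg hP v) fun h0 => hv ?_
  refine eq_zero_of_invariant hObs (fun w => quad P w = 0) (fun w hw => ?_) h0.symm
  obtain ⟨u, hu⟩ := exists_quad_step_eq A B C hR hP w
  rw [hfix, hw] at hu
  have h1 := quad_nonneg hP (A *ᵥ w + B *ᵥ u)
  have h2 := quad_nonneg hR.posSemidef u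
  have h3 := real_dotProduct_self_nonneg (C *ᵥ w)
  have hu0 : u = 0 := eq_zero_of_quad_eq_zero hR (by linarith)
  refine ⟨dotProduct_self_eq_zero.1 (by linarith), ?_⟩
  have : quad P (A *ᵥ w + B *ᵥ u) = 0 := by linarith
  simpa [hu0] using this

lemma exists_max_ratio {P D : Matrix (Fin n) (Fin n) ℝ} (hP : P.PosDef) {v₀ : Fin n → ℝ}
    (hv₀ : 0 < quad D v₀) :
    ∃ c > 0, (∀ v, quad D v ≤ c * quad P v) ∧ ∃ w ≠ 0, quad D w = c * quad P w := by
  have h₀ : v₀ ≠ 0 := by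
    rintro rfl
    simp [quad_zero] at hv₀
  have hmem : ∀ v : Fin n → ℝ, v ≠ 0 → ‖v‖⁻¹ • v ∈ Metric.sphere (0 : Fin n → ℝ) 1 := by
    intro v hv
    simp [norm_smul, norm_ne_zero_iff.2 hv]
  have hne : ∀ v ∈ Metric.sphere (0 : Fin n → ℝ) 1, v ≠ 0 := by
    rintro v hv rfl
    simp at hv
  obtain ⟨w, hw, hmax⟩ := (isCompact_sphere (0 : Fin n → ℝ) 1).exists_isMaxOn ⟨_, hmem v₀ h₀⟩
    (f := fun v => quad D v / quad P v)
    ((continuous_quad D).continuousOn.div (continuous_quad P).continuousOn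
      fun v hv => (quad_pos hP (hne v hv)).ne')
  have hle : ∀ v, v ≠ 0 → quad D v / quad P v ≤ quad D w / quad P w := by
    intro v hv
    have h := hmax (hmem v hv)
    have hn : (‖v‖⁻¹) ^ 2 ≠ 0 := by simpa using hv
    simpa only [Set.mem_ofPred_eq, quad_smul, mul_div_mul_left _ _ hn] using h
  refine ⟨quad D w / quad P w, (div_pos hv₀ (quad_pos hP h₀)).trans_le (hle v₀ h₀), fun v => ?_,
    w, hne w hw, (div_mul_cancel₀ _ (quad_pos hP (hne w hw)).ne').symm⟩
  rcases eq_or_ne v 0 with rfl | hv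
  · simp [quad_zero]
  · exact (div_le_iff₀ (quad_pos hP hv)).1 (hle v hv)

lemma quad_le_of_step_eq {A : Matrix (Fin n) (Fin n) ℝ} {B : Matrix (Fin n) (Fin m) ℝ}
    {C : Matrix (Fin p) (Fin n) ℝ} {R : Matrix (Fin m) (Fin m) ℝ} (hR : R.PosDef)
    (hObs : ∀ v : Fin n → ℝ, (∀ k < n, C *ᵥ ((A ^ k) *ᵥ v) = 0) → v = 0)
    {P Q : Matrix (Fin n) (Fin n) ℝ} (hP : P.PosDef) (hQ : Q.PosSemidef)
    (hPfix : step A B C R P = P) (hQfix : step A B C R Q = Q) (v : Fin n → ℝ) :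
    quad Q v ≤ quad P v := by
  have hsub : ∀ w, quad (Q - P) w = quad Q w - quad P w := fun w => by
    simp [quad, sub_mulVec]
  by_contra! hlt
  obtain ⟨c, hc, hle, w, hw, hweq⟩ := exists_max_ratio (D := Q - P) hP
    (v₀ := v) (by rw [hsub]; linarith)
  refine hw (eq_zero_of_invariant hObs (fun x => quad (Q - P) x = c * quad P x)
    (fun x hx => ?_) hweq)
  obtain ⟨u, hu⟩ := exists_quad_step_eq A B C hR hP.posSemidef x
  have hq := quad_step_le A B C hR hQ x u
  rw [hPfix] at hu
  rw [hQfix] at hq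
  have h2 := quad_nonneg hR.posSemidef u
  have h3 := real_dotProduct_self_nonneg (C *ᵥ x)
  have hy := hle (A *ᵥ x + B *ᵥ u)
  rw [hsub] at hx hy
  have hcost : c * (quad R u + (C *ᵥ x) ⬝ᵥ (C *ᵥ x)) ≤ 0 := by
    rw [hu] at hx
    linarith
  have hcost' : quad R u + (C *ᵥ x) ⬝ᵥ (C *ᵥ x) ≤ 0 := by
    by_contra! h
    exact absurd (mul_pos hc h) (not_lt.2 hcost)
  have hu0 : u = 0 := eq_zero_of_quad_eq_zero hR (by linarith)
  refine ⟨dotProduct_self_eq_zero.1 (by linarith), ?_⟩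
  have hPx : quad P x = quad P (A *ᵥ x + B *ᵥ u) := by linarith
  rw [hPx] at hx
  have : quad (Q - P) (A *ᵥ x + B *ᵥ u) = c * quad P (A *ᵥ x + B *ᵥ u) := by
    rw [hsub]
    linarith
  simpa [hu0] using this

lemma exists_control {A : Matrix (Fin n) (Fin n) ℝ} {B : Matrix (Fin n) (Fin m) ℝ}
    (hCtrb : ∀ v : Fin n → ℝ, (∀ k < n, Bᵀ *ᵥ ((Aᵀ ^ k) *ᵥ v) = 0) → v = 0) (w : Fin n → ℝ) :
    ∃ u : ℕ → Fin m → ℝ, w = ∑ i ∈ Finset.range n, (A ^ i) *ᵥ (B *ᵥ u i) := by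
  set G : Matrix (Fin n) (Fin n) ℝ := ∑ i ∈ Finset.range n, A ^ i * B * Bᵀ * Aᵀ ^ i with hG
  have hGv : ∀ v, G *ᵥ v = ∑ i ∈ Finset.range n, (A ^ i) *ᵥ (B *ᵥ (Bᵀ *ᵥ ((Aᵀ ^ i) *ᵥ v))) := by
    intro v
    simp only [hG, sum_mulVec, mulVec_mulVec, Matrix.mul_assoc]
  have hinj : Function.Injective G.mulVec := by
    rw [← coe_mulVecLin, ← LinearMap.ker_eq_bot, LinearMap.ker_eq_bot']
    intro v hv
    rw [mulVecLin_apply] at hv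
    have hsum : ∑ i ∈ Finset.range n,
        (Bᵀ *ᵥ ((Aᵀ ^ i) *ᵥ v)) ⬝ᵥ (Bᵀ *ᵥ ((Aᵀ ^ i) *ᵥ v)) = 0 := by
      have h : v ⬝ᵥ (G *ᵥ v) = 0 := by rw [hv, dotProduct_zero]
      rw [hGv, dotProduct_sum] at h
      rw [← h]
      refine Finset.sum_congr rfl fun i _ => ?_
      rw [dotProduct_mulVec v, ← mulVec_transpose, transpose_pow, dotProduct_mulVec _ B,
        ← mulVec_transpose]
    rw [Finset.sum_eq_zero_iff_of_nonneg fun i _ => real_dotProduct_self_nonneg _] at hsum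
    exact hCtrb v fun k hk => dotProduct_self_eq_zero.1 (hsum k (Finset.mem_range.2 hk))
  obtain ⟨v, hv⟩ := mulVec_surjective_iff_isUnit.2 (mulVec_injective_iff_isUnit.1 hinj) w
  exact ⟨fun i => Bᵀ *ᵥ ((Aᵀ ^ i) *ᵥ v), by rw [← hGv, ← hv]⟩

section Iterate

variable {A : Matrix (Fin n) (Fin n) ℝ} {B : Matrix (Fin n) (Fin m) ℝ}
  {C : Matrix (Fin p) (Fin n) ℝ} {R : Matrix (Fin m) (Fin m) ℝ}

lemma posSemidef_iterate (hR : R.PosDef) (k : ℕ) : ((step A B C R)^[k] 0).PosSemidef := by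
  induction k with
  | zero => exact PosSemidef.zero
  | succ k ih =>
    rw [Function.iterate_succ_apply']
    exact posSemidef_step A B C hR ih

lemma monotone_quad_iterate (hR : R.PosDef) (v : Fin n → ℝ) :
    Monotone fun k => quad ((step A B C R)^[k] 0) v := by
  refine monotone_nat_of_le_succ fun k => ?_
  induction k generalizing v with
  | zero =>
    have h := quad_nonneg (posSemidef_iterate (A := A) (B := B) (C := C) hR 1) v
    simpa [quad] using h
  | succ k ih =>
    simp only [Function.iterate_succ_apply'] at ih ⊢
    refine quad_step_mono A B C hR (posSemidef_iterate hR k) ?_ ih v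
    exact posSemidef_step A B C hR (posSemidef_iterate hR k)

lemma bddAbove_quad_iterate_of_steerable (hR : R.PosDef) (u : ℕ → Fin m → ℝ) (j : ℕ)
    (v : Fin n → ℝ) (hv : (A ^ j) *ᵥ v = ∑ i ∈ Finset.range j, (A ^ i) *ᵥ (B *ᵥ u i)) :
    BddAbove (Set.range fun k => quad ((step A B C R)^[k] 0) v) := by
  induction j generalizing v with
  | zero =>
    have : v = 0 := by simpa using hv
    subst this
    exact ⟨0, by rintro _ ⟨k, rfl⟩; simp [quad_zero]⟩
  | succ j ih =>
    obtain ⟨c, hc⟩ := ih (A *ᵥ v + B *ᵥ (-u j)) (by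
      rw [Finset.sum_range_succ, pow_succ, ← mulVec_mulVec] at hv
      rw [mulVec_add, hv, mulVec_neg, mulVec_neg, add_neg_cancel_right])
    refine ⟨c + quad R (-u j) + (C *ᵥ v) ⬝ᵥ (C *ᵥ v), ?_⟩
    rintro _ ⟨k, rfl⟩
    refine (monotone_quad_iterate hR v k.le_succ).trans ?_
    simp only [Function.iterate_succ_apply']
    have h := quad_step_le A B C hR (posSemidef_iterate (A := A) (B := B) (C := C) hR k) v (-u j)
    have hk : _ ≤ c := hc ⟨k, rfl⟩
    linarith

lemma exists_step_eq (hR : R.PosDef)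
    (hCtrb : ∀ v : Fin n → ℝ, (∀ k < n, Bᵀ *ᵥ ((Aᵀ ^ k) *ᵥ v) = 0) → v = 0) :
    ∃ P : Matrix (Fin n) (Fin n) ℝ, P.PosSemidef ∧ step A B C R P = P := by
  have hlim : ∀ v, ∃ l, Tendsto (fun k => quad ((step A B C R)^[k] 0) v) atTop (𝓝 l) := by
    intro v
    obtain ⟨u, hu⟩ := exists_control hCtrb ((A ^ n) *ᵥ v)
    exact ⟨_, tendsto_atTop_ciSup (monotone_quad_iterate hR v)
      (bddAbove_quad_iterate_of_steerable hR u n v hu)⟩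
  choose l hl using hlim
  obtain ⟨P, hP⟩ : ∃ P, Tendsto (fun k => (step A B C R)^[k] 0) atTop (𝓝 P) := by
    refine ⟨Matrix.of fun i j => (l (Pi.single i 1 + Pi.single j 1) - l (Pi.single i 1)
      - l (Pi.single j 1)) / 2, tendsto_pi_nhds.2 fun i => tendsto_pi_nhds.2 fun j => ?_⟩
    simp only [fun k => apply_eq_quad
      (transpose_eq (posSemidef_iterate (A := A) (B := B) (C := C) hR k)) i j]
    exact (((hl _).sub (hl _)).sub (hl _)).div_const 2
  have hPsd : P.PosSemidef := by
    refine PosSemidef.of_dotProduct_mulVec_nonneg ?_ fun v => ?_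
    · have ht : Tendsto (fun k => ((step A B C R)^[k] 0)ᵀ) atTop (𝓝 Pᵀ) :=
        (continuous_id.matrix_transpose.tendsto P).comp hP
      simp only [fun k => transpose_eq (posSemidef_iterate (A := A) (B := B) (C := C) hR k)] at ht
      simpa [IsHermitian] using tendsto_nhds_unique ht hP
    · have hc : Continuous fun X : Matrix (Fin n) (Fin n) ℝ => quad X v := by
        unfold quad
        fun_prop
      have := ge_of_tendsto' ((hc.tendsto P).comp hP) fun k => quad_nonneg (posSemidef_iterate hR k) v
      simpa [quad] using this
  refine ⟨P, hPsd, tendsto_nhds_unique ?_ ((tendsto_add_atTop_iff_nat 1).2 hP)⟩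
  simp only [Function.iterate_succ_apply']
  exact (continuousAt_step A B C hR hPsd).tendsto.comp hP

end Iterate

end Riccati

/-- If `(A,B)` is controllable and `(A,C)` observable, the discrete-time
algebraic Riccati equation has a unique positive definite solution. -/
theorem dare_exists_unique
    {n m p : ℕ} (A : Matrix (Fin n) (Fin n) ℝ) (B : Matrix (Fin n) (Fin m) ℝ)
    (C : Matrix (Fin p) (Fin n) ℝ) (R : Matrix (Fin m) (Fin m) ℝ)
    (hR : R.PosDef)
    (hCtrb : ∀ v : Fin n → ℝ, (∀ k < n, Bᵀ *ᵥ ((Aᵀ ^ k) *ᵥ v) = 0) → v = 0)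
    (hObs : ∀ v : Fin n → ℝ, (∀ k < n, C *ᵥ ((A ^ k) *ᵥ v) = 0) → v = 0) :
    ∃! P : Matrix (Fin n) (Fin n) ℝ, P.PosDef ∧
      P = Aᵀ * P * A - Aᵀ * P * B * (R + Bᵀ * P * B)⁻¹ * Bᵀ * P * A
        + Cᵀ * C := by
  obtain ⟨P, hPsd, hfix⟩ := Riccati.exists_step_eq (C := C) hR hCtrb
  have hP := Riccati.posDef_of_step_eq hR hObs hPsd hfix
  refine ⟨P, ⟨hP, hfix.symm⟩, fun Q ⟨hQ, hQeq⟩ => ?_⟩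
  have hQfix : Riccati.step A B C R Q = Q := hQeq.symm
  have hquad : Riccati.quad Q = Riccati.quad P := funext fun v =>
    (Riccati.quad_le_of_step_eq hR hObs hP hQ.posSemidef hfix hQfix v).antisymm
      (Riccati.quad_le_of_step_eq hR hObs hQ hPsd hQfix hfix v)
  ext i j
  rw [Riccati.apply_eq_quad (Riccati.transpose_eq hQ.posSemidef), hquad,
    ← Riccati.apply_eq_quad (Riccati.transpose_eq hPsd)]
end

section
/- If (A,B) is controllable and (A,C) is observable, then the continuous-time algebraic Riccati equation AᵀP + PA − PBR⁻¹BᵀP + CᵀC = 0 with R ≻ 0 has a unique positive definite solution P. -/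
open Matrix

section PosSemidef

variable {ι κ : Type*} [Fintype ι] [Fintype κ]

theorem posSemidef_real_iff {M : Matrix ι ι ℝ} :
    M.PosSemidef ↔ Mᵀ = M ∧ ∀ x : ι → ℝ, 0 ≤ x ⬝ᵥ M *ᵥ x := by
  simp [posSemidef_iff_dotProduct_mulVec, IsHermitian]

theorem posSemidef_mulVec_eq_zero {M : Matrix ι ι ℝ} (hM : M.PosSemidef) {x : ι → ℝ}
    (h : x ⬝ᵥ M *ᵥ x = 0) : M *ᵥ x = 0 :=
  (hM.dotProduct_mulVec_zero_iff x).1 (by simpa using h)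

theorem isClosed_posSemidef : IsClosed {M : Matrix ι ι ℝ | M.PosSemidef} := by
  simp only [posSemidef_real_iff, Set.ofPred_and, Set.ofPred_forall]
  refine (isClosed_eq (by fun_prop) (by fun_prop)).inter (isClosed_iInter fun x => ?_)
  exact isClosed_le (by fun_prop) (by fun_prop)

theorem abs_apply_le_trace {M : Matrix ι ι ℝ} (hM : M.PosSemidef) (i j : ι) :
    |M i j| ≤ M.trace := by
  classical
  have hq := (posSemidef_real_iff.1 hM).2
  have hs : M j i = M i j := congrFun (congrFun (posSemidef_real_iff.1 hM).1 i) j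
  have hd : ∀ k, M k k ≤ M.trace := fun k =>
    Finset.single_le_sum (f := fun k => M k k) (fun l _ => hM.diag_nonneg) (Finset.mem_univ k)
  have h1 := hq (Pi.single i 1 + Pi.single j 1)
  have h2 := hq (Pi.single i 1 - Pi.single j 1)
  simp [mulVec_add, mulVec_sub, add_dotProduct, sub_dotProduct] at h1 h2
  rw [abs_le]
  constructor <;> linarith [hd i, hd j]

theorem isCompact_posSemidef_trace_le (c : ℝ) :
    IsCompact {M : Matrix ι ι ℝ | M.PosSemidef ∧ M.trace ≤ c} := by
  have hK : IsCompact (Set.univ.pi fun _ => Set.univ.pi fun _ => Set.Icc (-c) c :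
      Set (ι → ι → ℝ)) :=
    isCompact_univ_pi fun _ => isCompact_univ_pi fun _ => isCompact_Icc
  refine IsCompact.of_isClosed_subset (X := Matrix ι ι ℝ) hK
    (isClosed_posSemidef.inter (isClosed_le (f := fun M : Matrix ι ι ℝ => M.trace) (by fun_prop) continuous_const)) ?_
  rintro M ⟨hM, hc⟩ i - j -
  exact abs_le.1 ((abs_apply_le_trace hM i j).trans hc)

open MatrixOrder in
theorem exists_eq_transpose_mul_self {M : Matrix ι ι ℝ} (hM : M.PosSemidef) :
    ∃ N : Matrix ι ι ℝ, M = Nᵀ * N := by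
  classical
  obtain ⟨N, hN⟩ := CStarAlgebra.nonneg_iff_eq_star_mul_self.mp (hM.nonneg)
  exact ⟨N, by simpa [star_eq_conjTranspose] using hN⟩

theorem posSemidef_transpose_mul_mul {M : Matrix ι ι ℝ} (hM : M.PosSemidef) (N : Matrix ι κ ℝ) :
    (Nᵀ * M * N).PosSemidef := by
  simpa using hM.conjTranspose_mul_mul_same N

theorem trace_mul_nonneg {M N : Matrix ι ι ℝ} (hM : M.PosSemidef) (hN : N.PosSemidef) :
    0 ≤ (M * N).trace := by
  obtain ⟨V, rfl⟩ := exists_eq_transpose_mul_self hM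
  rw [Matrix.mul_assoc, trace_mul_comm]
  simpa using (hN.mul_mul_conjTranspose_same V).trace_nonneg

theorem mul_eq_zero_of_trace_mul_eq_zero {M N : Matrix ι ι ℝ} (hM : M.PosSemidef)
    (hN : N.PosSemidef) (h : (M * N).trace = 0) : M * N = 0 := by
  obtain ⟨V, rfl⟩ := exists_eq_transpose_mul_self hM
  obtain ⟨W, rfl⟩ := exists_eq_transpose_mul_self hN
  have h1 : ((W * Vᵀ)ᴴ * (W * Vᵀ)).trace = 0 := by
    rw [← h, Matrix.mul_assoc Vᵀ, trace_mul_comm Vᵀ]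
    simp [Matrix.mul_assoc]
  have h2 := trace_conjTranspose_mul_self_eq_zero_iff.1 h1
  have h3 : V * Wᵀ = 0 := by simpa using congrArg transpose h2
  rw [Matrix.mul_assoc, ← Matrix.mul_assoc V, h3]
  simp

end PosSemidef

section Rank

variable {ι κ : Type*} [Fintype ι] [DecidableEq ι]

/-- The Lyapunov form of the controllability test. -/
theorem eq_zero_of_lyapunov_of_controllable {A P : Matrix ι ι ℝ} {B : Matrix ι κ ℝ} {N : ℕ}
    (hc : ∀ v : ι → ℝ, (∀ k < N, Bᵀ *ᵥ ((Aᵀ ^ k) *ᵥ v) = 0) → v = 0)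
    (hP : Pᵀ = P) (hBP : P * B = 0) (hM : (Aᵀ * P + P * A).PosSemidef) : P = 0 := by
  have key : ∀ k, P * (A ^ k * B) = 0 := by
    intro k
    induction k with
    | zero => simpa using hBP
    | succ k ih =>
      have ih' : (A ^ k * B)ᵀ * P = 0 := by simpa [hP] using congrArg transpose ih
      have h1 : (Aᵀ * P + P * A) * (A ^ k * B) = 0 := by
        ext i j
        have hq : (fun i => (A ^ k * B) i j) ⬝ᵥ (Aᵀ * P + P * A) *ᵥ (fun i => (A ^ k * B) i j) =
            ((A ^ k * B)ᵀ * ((Aᵀ * P + P * A) * (A ^ k * B))) j j := rfl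
        have h2 : (A ^ k * B)ᵀ * ((Aᵀ * P + P * A) * (A ^ k * B)) = 0 := by
          rw [Matrix.add_mul, Matrix.mul_add, Matrix.mul_assoc Aᵀ, ih, Matrix.mul_assoc P,
            ← Matrix.mul_assoc _ P, ih']
          simp
        rw [h2] at hq
        exact congrFun (posSemidef_mulVec_eq_zero hM hq) i
      rw [Matrix.add_mul, Matrix.mul_assoc Aᵀ, ih] at h1
      simpa [pow_succ', Matrix.mul_assoc] using h1
  have hv : ∀ v, P *ᵥ v = 0 := by
    intro v
    refine hc _ fun k _ => ?_
    have := congrArg transpose (key k)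
    simp only [transpose_mul, transpose_pow, hP, transpose_zero] at this
    rw [mulVec_mulVec, mulVec_mulVec, this, zero_mulVec]
  ext i j
  simpa using congrFun (hv (Pi.single j 1)) i

/-- An `A`-invariant subspace contained in the kernel of `C` is trivial. -/
theorem eq_zero_of_invariant_of_observable {A M : Matrix ι ι ℝ} {C : Matrix κ ι ℝ} {N : ℕ}
    (ho : ∀ v : ι → ℝ, (∀ k < N, C *ᵥ ((A ^ k) *ᵥ v) = 0) → v = 0)
    (hC : ∀ v, M *ᵥ v = 0 → C *ᵥ v = 0) (hA : ∀ v, M *ᵥ v = 0 → M *ᵥ (A *ᵥ v) = 0)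
    {v : ι → ℝ} (hv : M *ᵥ v = 0) : v = 0 := by
  have key : ∀ k, M *ᵥ ((A ^ k) *ᵥ v) = 0 := by
    intro k
    induction k with
    | zero => simpa using hv
    | succ k ih => rw [pow_succ', ← mulVec_mulVec]; exact hA _ ih
  exact ho v fun k _ => hC _ (key k)

end Rank

section Uniqueness

variable {ι κ : Type*} [Fintype ι] [Fintype κ]

theorem exists_singular_shift {D P : Matrix ι ι ℝ} (hD : Dᵀ = D) (hP : P.PosDef)
    (hn : ¬ D.PosSemidef) :
    ∃ μ : ℝ, μ < 0 ∧ (D - μ • P).PosSemidef ∧ ∃ v ≠ 0, (D - μ • P) *ᵥ v = 0 := by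
  have hpos : ∀ x : ι → ℝ, x ≠ 0 → 0 < x ⬝ᵥ P *ᵥ x := fun x hx => by
    simpa using hP.dotProduct_mulVec_pos hx
  have hPs : Pᵀ = P := by simpa [IsHermitian] using hP.isHermitian
  obtain ⟨y, hy⟩ : ∃ y : ι → ℝ, y ⬝ᵥ D *ᵥ y < 0 := by
    by_contra! h
    exact hn (posSemidef_real_iff.2 ⟨hD, h⟩)
  have hy0 : y ≠ 0 := by rintro rfl; simp at hy
  have hscale : ∀ x : ι → ℝ, x ≠ 0 → ‖x‖⁻¹ • x ∈ Metric.sphere (0 : ι → ℝ) 1 := fun x hx => by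
    simp [norm_smul, hx]
  have hcont : ContinuousOn (fun x : ι → ℝ => (x ⬝ᵥ D *ᵥ x) / (x ⬝ᵥ P *ᵥ x))
      (Metric.sphere 0 1) := by
    refine ContinuousOn.div (by fun_prop) (by fun_prop) fun x hx => (hpos x ?_).ne'
    rintro rfl
    simp at hx
  obtain ⟨v, hv, hmin⟩ := (isCompact_sphere (0 : ι → ℝ) 1).exists_isMinOn
    ⟨_, hscale y hy0⟩ hcont
  have hv0 : v ≠ 0 := by rintro rfl; simp at hv
  have hle : ∀ x : ι → ℝ, x ≠ 0 →
      (v ⬝ᵥ D *ᵥ v) / (v ⬝ᵥ P *ᵥ v) ≤ (x ⬝ᵥ D *ᵥ x) / (x ⬝ᵥ P *ᵥ x) := fun x hx => by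
    have h := isMinOn_iff.1 hmin _ (hscale x hx)
    have hc : ‖x‖⁻¹ ≠ 0 := by simpa using hx
    simpa [mulVec_smul, mul_div_mul_left _ _ hc] using h
  set μ := (v ⬝ᵥ D *ᵥ v) / (v ⬝ᵥ P *ᵥ v) with hμ
  have hM : (D - μ • P).PosSemidef := by
    refine posSemidef_real_iff.2 ⟨by simp [hD, hPs], fun x => ?_⟩
    rcases eq_or_ne x 0 with rfl | hx
    · simp
    · have := (le_div_iff₀ (hpos x hx)).1 (hle x hx)
      simp only [sub_mulVec, smul_mulVec, dotProduct_sub, dotProduct_smul, smul_eq_mul]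
      linarith
  refine ⟨μ, (hle y hy0).trans_lt (div_neg_of_neg_of_pos hy (hpos y hy0)), hM, v, hv0,
    posSemidef_mulVec_eq_zero hM ?_⟩
  have : μ * (v ⬝ᵥ P *ᵥ v) = v ⬝ᵥ D *ᵥ v := div_mul_cancel₀ _ (hpos v hv0).ne'
  simp only [sub_mulVec, smul_mulVec, dotProduct_sub, dotProduct_smul, smul_eq_mul]
  linarith

variable [DecidableEq ι] {A S P : Matrix ι ι ℝ} {C : Matrix κ ι ℝ} {N : ℕ}

theorem riccati_posDef
    (ho : ∀ v : ι → ℝ, (∀ k < N, C *ᵥ ((A ^ k) *ᵥ v) = 0) → v = 0)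
    (hP : P.PosSemidef) (h : Aᵀ * P + P * A - P * S * P + Cᵀ * C = 0) : P.PosDef := by
  have hPs := (posSemidef_real_iff.1 hP).1
  have hvec : ∀ v, P *ᵥ v = 0 → P *ᵥ (A *ᵥ v) + Cᵀ *ᵥ (C *ᵥ v) = 0 := fun v hv => by
    have := congrArg (· *ᵥ v) h
    simpa [add_mulVec, sub_mulVec, ← mulVec_mulVec, hv] using this
  have hC : ∀ v, P *ᵥ v = 0 → C *ᵥ v = 0 := fun v hv => by
    have h1 := congrArg (v ⬝ᵥ ·) (hvec v hv)
    have h2 : v ᵥ* P = 0 := by rw [← hPs, vecMul_transpose, hv]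
    simp only [dotProduct_add, dotProduct_mulVec _ P, h2, dotProduct_mulVec _ Cᵀ,
      vecMul_transpose, zero_dotProduct, zero_add, dotProduct_zero] at h1
    exact dotProduct_self_eq_zero.1 h1
  refine PosDef.of_dotProduct_mulVec_pos hP.1 fun {v} hv => ?_
  rw [star_trivial]
  refine lt_of_le_of_ne ((posSemidef_real_iff.1 hP).2 v) fun h0 => hv ?_
  refine eq_zero_of_invariant_of_observable ho hC (fun w hw => ?_)
    (posSemidef_mulVec_eq_zero hP h0.symm)
  simpa [hC w hw] using hvec w hw

theorem riccati_le {P' : Matrix ι ι ℝ} (hS : S.PosSemidef)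
    (ho : ∀ v : ι → ℝ, (∀ k < N, C *ᵥ ((A ^ k) *ᵥ v) = 0) → v = 0)
    (hP : P.PosDef) (hP' : P'ᵀ = P') (h : Aᵀ * P + P * A - P * S * P + Cᵀ * C = 0)
    (h' : Aᵀ * P' + P' * A - P' * S * P' + Cᵀ * C = 0) : (P - P').PosSemidef := by
  have hPs := (posSemidef_real_iff.1 hP.posSemidef).1
  have hSs := (posSemidef_real_iff.1 hS).1
  by_contra hn
  obtain ⟨μ, hμ, hM, v, hv0, hv⟩ := exists_singular_shift (by simp [hPs, hP']) hP hn
  set D := P - P' with hD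
  set M := D - μ • P with hMd
  have hMs := (posSemidef_real_iff.1 hM).1
  have hDs : Dᵀ = D := by simp [hD, hPs, hP']
  have hlyap : (A - S * P)ᵀ * M + M * (A - S * P) =
      μ • (Cᵀ * C + P * S * P) - D * S * D := by
    have e1 : Aᵀ * P' + P' * A = P' * S * P' - Cᵀ * C := by
      rw [← sub_eq_zero, ← h']
      abel
    have e2 : Aᵀ * P + P * A = P * S * P - Cᵀ * C := by
      rw [← sub_eq_zero, ← h]
      abel
    simp only [hMd, hD, transpose_sub, transpose_mul, hPs, hSs]
    have e3 : (Aᵀ - P * S) * (P - P' - μ • P) + (P - P' - μ • P) * (A - S * P) =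
      (1 - μ) • (Aᵀ * P + P * A) - (Aᵀ * P' + P' * A) - (2 - 2 * μ) • (P * S * P)
        + P * S * P' + P' * S * P := by
      simp only [Matrix.sub_mul, Matrix.mul_sub, Matrix.mul_smul, Matrix.smul_mul, Matrix.mul_assoc]
      module
    rw [e3, e1, e2]
    simp only [Matrix.sub_mul, Matrix.mul_sub, Matrix.mul_assoc]
    module
  have hvec : ∀ w, M *ᵥ w = 0 → M *ᵥ ((A - S * P) *ᵥ w) =
      μ • (Cᵀ *ᵥ (C *ᵥ w) + P *ᵥ (S *ᵥ (P *ᵥ w))) - D *ᵥ (S *ᵥ (D *ᵥ w)) := fun w hw => by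
    have := congrArg (· *ᵥ w) hlyap
    simpa only [add_mulVec, sub_mulVec, smul_mulVec, ← mulVec_mulVec, hw, mulVec_zero,
      zero_add] using this
  have hq : ∀ w, M *ᵥ w = 0 → C *ᵥ w = 0 ∧ S *ᵥ (P *ᵥ w) = 0 ∧ S *ᵥ (D *ᵥ w) = 0 := fun w hw => by
    have h1 := congrArg (w ⬝ᵥ ·) (hvec w hw)
    have hwM : w ᵥ* M = 0 := by rw [← hMs, vecMul_transpose, hw]
    have hwP : w ᵥ* P = P *ᵥ w := by rw [← vecMul_transpose, hPs]
    have hwD : w ᵥ* D = D *ᵥ w := by rw [← vecMul_transpose, hDs]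
    simp only [dotProduct_mulVec w M, hwM, zero_dotProduct, dotProduct_sub, dotProduct_smul,
      dotProduct_add, dotProduct_mulVec w Cᵀ, vecMul_transpose, dotProduct_mulVec w P, hwP,
      dotProduct_mulVec w D, hwD, smul_eq_mul] at h1
    have c1 : 0 ≤ (C *ᵥ w) ⬝ᵥ (C *ᵥ w) := by
      simpa using dotProduct_star_self_nonneg (C *ᵥ w)
    have c2 := (posSemidef_real_iff.1 hS).2 (P *ᵥ w)
    have c3 := (posSemidef_real_iff.1 hS).2 (D *ᵥ w)
    have c4 : (C *ᵥ w) ⬝ᵥ (C *ᵥ w) = 0 := by nlinarith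
    have c5 : (P *ᵥ w) ⬝ᵥ S *ᵥ (P *ᵥ w) = 0 := by nlinarith
    have c6 : (D *ᵥ w) ⬝ᵥ S *ᵥ (D *ᵥ w) = 0 := by nlinarith
    exact ⟨dotProduct_self_eq_zero.1 c4, posSemidef_mulVec_eq_zero hS c5,
      posSemidef_mulVec_eq_zero hS c6⟩
  refine hv0 (eq_zero_of_invariant_of_observable ho (fun w hw => (hq w hw).1)
    (fun w hw => ?_) hv)
  obtain ⟨h1, h2, h3⟩ := hq w hw
  have := hvec w hw
  simpa [sub_mulVec, ← mulVec_mulVec, h1, h2, h3] using this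

theorem riccati_unique {P' : Matrix ι ι ℝ} (hS : S.PosSemidef)
    (ho : ∀ v : ι → ℝ, (∀ k < N, C *ᵥ ((A ^ k) *ᵥ v) = 0) → v = 0)
    (hP : P.PosDef) (hP' : P'.PosDef) (h : Aᵀ * P + P * A - P * S * P + Cᵀ * C = 0)
    (h' : Aᵀ * P' + P' * A - P' * S * P' + Cᵀ * C = 0) : P = P' := by
  have h1 := riccati_le hS ho hP (posSemidef_real_iff.1 hP'.posSemidef).1 h h'
  have h2 := riccati_le hS ho hP' (posSemidef_real_iff.1 hP.posSemidef).1 h' h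
  have ht : (P - P').trace = 0 := by
    have h3 := h1.trace_nonneg
    have h4 := h2.trace_nonneg
    rw [trace_sub] at h3 h4 ⊢
    linarith
  exact sub_eq_zero.1 (h1.trace_eq_zero_iff.1 ht)

end Uniqueness

section Duality

variable {ι σ : Type*} [Fintype ι] [Fintype σ] {J E : Matrix ι σ ℝ} {G : Matrix σ σ ℝ}

/-- The linear matrix inequality has a feasible point of maximal trace. -/
theorem exists_max_trace
    (hinj : ∀ D : Matrix ι ι ℝ, D.PosSemidef → (Jᵀ * D * E + Eᵀ * D * J).PosSemidef → D = 0)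
    (hG : G.PosSemidef) :
    ∃ P : Matrix ι ι ℝ, P.PosSemidef ∧ (Jᵀ * P * E + Eᵀ * P * J + G).PosSemidef ∧
      ∀ P' : Matrix ι ι ℝ, P'.PosSemidef → (Jᵀ * P' * E + Eᵀ * P' * J + G).PosSemidef →
        P'.trace ≤ P.trace := by
  set T : Set (Matrix ι ι ℝ × ℝ) := {x | x.1.PosSemidef ∧ 0 ≤ x.2 ∧ x.1.trace + x.2 = 1 ∧
    (Jᵀ * x.1 * E + Eᵀ * x.1 * J + x.2 • G).PosSemidef}
  have hcpt : IsCompact T := by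
    refine ((isCompact_posSemidef_trace_le (ι := ι) 1).prod
      (isCompact_Icc (a := (0 : ℝ)) (b := 1))).of_isClosed_subset ?_ ?_
    · refine (isClosed_posSemidef.preimage continuous_fst).inter
        ((isClosed_le continuous_const continuous_snd).inter
          ((isClosed_eq (f := fun x : Matrix ι ι ℝ × ℝ => x.1.trace + x.2)
            (by fun_prop) continuous_const).inter
          (isClosed_posSemidef.preimage (f := fun x : Matrix ι ι ℝ × ℝ =>
            Jᵀ * x.1 * E + Eᵀ * x.1 * J + x.2 • G) (by fun_prop))))
    · rintro ⟨D, δ⟩ ⟨h1, h2, h3, -⟩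
      have := h1.trace_nonneg
      simp only at h2 h3
      exact ⟨⟨h1, by simp only; linarith⟩, h2, by simp only; linarith⟩
  obtain ⟨⟨D, δ⟩, ⟨hD, hδ, htr, hF⟩, hmin⟩ := hcpt.exists_isMinOn
    ⟨(0, 1), PosSemidef.zero, zero_le_one, by simp, by simpa using hG⟩ continuous_snd.continuousOn
  simp only at hD hδ htr hF
  have hδ0 : 0 < δ := by
    refine lt_of_le_of_ne hδ fun h => ?_
    subst h
    have := hinj D hD (by simpa using hF)
    simp [this] at htr
  refine ⟨δ⁻¹ • D, hD.smul (by positivity), ?_, fun P' hP' hF' => ?_⟩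
  · have := hF.smul (inv_nonneg.2 hδ)
    simpa [smul_add, smul_smul, hδ0.ne'] using this
  · have ht := hP'.trace_nonneg
    have hc : 0 < (1 + P'.trace)⁻¹ := by positivity
    have h1 := isMinOn_iff.1 hmin ((1 + P'.trace)⁻¹ • P', (1 + P'.trace)⁻¹)
      ⟨hP'.smul hc.le, hc.le, by simp only [trace_smul, smul_eq_mul]; field_simp; ring, by
        have := hF'.smul hc.le
        simpa [smul_add] using this⟩
    simp only at h1
    have h2 : 1 + P'.trace ≤ δ⁻¹ := (le_inv_comm₀ hδ0 (by positivity)).1 h1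
    have h3 : D.trace = 1 - δ := by linarith
    rw [trace_smul, smul_eq_mul, h3, mul_sub, inv_mul_cancel₀ hδ0.ne']
    linarith

theorem trace_mul_lyapunov (Z : Matrix σ σ ℝ) (D : Matrix ι ι ℝ) :
    (Z * (Jᵀ * D * E + Eᵀ * D * J)).trace = (D * (J * Z * Eᵀ + E * Z * Jᵀ)).trace := by
  have h : ∀ K L : Matrix ι σ ℝ, (Z * (Kᵀ * D * L)).trace = (D * (L * Z * Kᵀ)).trace := by
    intro K L
    rw [← Matrix.mul_assoc, trace_mul_comm, ← Matrix.mul_assoc, ← Matrix.mul_assoc,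
      trace_mul_comm, ← Matrix.mul_assoc]
  rw [Matrix.mul_add, Matrix.mul_add, trace_add, trace_add, h, h, add_comm]

instance matrixLocallyConvexSpace : LocallyConvexSpace ℝ (Matrix ι ι ℝ) :=
  inferInstanceAs (LocallyConvexSpace ℝ (ι → ι → ℝ))

theorem exists_trace_repr [DecidableEq ι] (f : Matrix ι ι ℝ →ₗ[ℝ] ℝ) :
    ∃ D : Matrix ι ι ℝ, ∀ M, f M = (D * M).trace := by
  refine ⟨Matrix.of fun i j => f (single j i 1), fun M => ?_⟩
  conv_lhs => rw [matrix_eq_sum_single M]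
  simp only [map_sum, trace, diag, mul_apply, of_apply]
  rw [Finset.sum_comm]
  refine Finset.sum_congr rfl fun i _ => Finset.sum_congr rfl fun j _ => ?_
  rw [← mul_one (M j i), ← smul_eq_mul, ← smul_single, map_smul, smul_eq_mul, smul_eq_mul, mul_one,
    mul_comm]

theorem posSemidef_of_trace_nonneg {M : Matrix ι ι ℝ} (hM : Mᵀ = M)
    (h : ∀ Z : Matrix ι ι ℝ, Z.PosSemidef → Z.trace = 1 → 0 ≤ (Z * M).trace) : M.PosSemidef := by
  refine posSemidef_real_iff.2 ⟨hM, fun x => ?_⟩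
  rcases eq_or_ne x 0 with rfl | hx
  · simp
  have hpos : 0 < x ⬝ᵥ x := by
    simpa using dotProduct_star_self_pos_iff.2 hx
  have hps : (vecMulVec x x).PosSemidef := by simpa using posSemidef_vecMulVec_self_star x
  have h1 := h ((x ⬝ᵥ x)⁻¹ • vecMulVec x x) (hps.smul (by positivity)) (by
    rw [trace_smul, trace_vecMulVec, smul_eq_mul, inv_mul_cancel₀ hpos.ne'])
  rw [smul_mul, trace_smul, smul_eq_mul, vecMulVec_mul, trace_vecMulVec, dotProduct_comm x (x ᵥ* M),
    ← dotProduct_mulVec] at h1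
  exact nonneg_of_mul_nonneg_right h1 (by positivity)

theorem inv_add_one_smul_add {V : Type*} [AddCommGroup V] [Module ℝ V] {t : ℝ} (ht : 0 ≤ t)
    (x y : V) : (t + 1)⁻¹ • ((x + t • y) + y) = (t + 1)⁻¹ • x + y := by
  have h : (x + t • y) + y = x + (t + 1) • y := by module
  rw [h, smul_add, smul_smul, inv_mul_cancel₀ (by positivity), one_smul]

/-- Lagrange multipliers for trace maximization under the linear matrix inequality. -/
theorem exists_multiplier [DecidableEq ι]
    (hinj : ∀ Z : Matrix σ σ ℝ, ∀ Y : Matrix ι ι ℝ, Z.PosSemidef → Y.PosSemidef →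
      J * Z * Eᵀ + E * Z * Jᵀ + Y = 0 → (Z * G).trace = 0 → Z = 0)
    (hG : G.PosSemidef) {P : Matrix ι ι ℝ} (hP : P.PosSemidef)
    (hF : (Jᵀ * P * E + Eᵀ * P * J + G).PosSemidef)
    (hmax : ∀ P' : Matrix ι ι ℝ, P'.PosSemidef → (Jᵀ * P' * E + Eᵀ * P' * J + G).PosSemidef →
        P'.trace ≤ P.trace) :
    ∃ Z : Matrix σ σ ℝ, ∃ Y : Matrix ι ι ℝ, Z.PosSemidef ∧ Y.PosSemidef ∧
      J * Z * Eᵀ + E * Z * Jᵀ + Y + 1 = 0 ∧ (Z * (Jᵀ * P * E + Eᵀ * P * J + G)).trace = 0 := by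
  set F := Jᵀ * P * E + Eᵀ * P * J + G with hFd
  have hPs := (posSemidef_real_iff.1 hP).1
  set Ω : Set (Matrix σ σ ℝ × Matrix ι ι ℝ × ℝ) := {x | x.1.PosSemidef ∧ x.2.1.PosSemidef ∧
    0 ≤ x.2.2 ∧ x.1.trace + x.2.1.trace + x.2.2 = 1}
  set Λ : Matrix σ σ ℝ × Matrix ι ι ℝ × ℝ → Matrix ι ι ℝ × ℝ := fun x =>
    (J * x.1 * Eᵀ + E * x.1 * Jᵀ + x.2.1 + x.2.2 • 1, (x.1 * F).trace + (P * x.2.1).trace) with hΛ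
  have hcpt : IsCompact Ω := by
    refine ((isCompact_posSemidef_trace_le (ι := σ) 1).prod
      ((isCompact_posSemidef_trace_le (ι := ι) 1).prod
      (isCompact_Icc (a := (0 : ℝ)) (b := 1)))).of_isClosed_subset ?_ ?_
    · exact (isClosed_posSemidef.preimage continuous_fst).inter
        ((isClosed_posSemidef.preimage (continuous_fst.comp continuous_snd)).inter
        ((isClosed_le continuous_const (continuous_snd.comp continuous_snd)).inter
          (isClosed_eq (f := fun x : Matrix σ σ ℝ × Matrix ι ι ℝ × ℝ =>
            x.1.trace + x.2.1.trace + x.2.2) (by fun_prop) continuous_const)))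
    · rintro ⟨Z, Y, s⟩ ⟨h1, h2, h3, h4⟩
      have := h1.trace_nonneg
      have := h2.trace_nonneg
      simp only at h3 h4
      exact ⟨⟨h1, by simp only; linarith⟩, ⟨h2, by simp only; linarith⟩, h3, by
        simp only; linarith⟩
  have hconv : Convex ℝ Ω := by
    rintro ⟨Z, Y, s⟩ ⟨h1, h2, h3, h4⟩ ⟨Z', Y', s'⟩ ⟨h1', h2', h3', h4'⟩ a b ha hb hab
    simp only at h3 h4 h3' h4'
    refine ⟨(h1.smul ha).add (h1'.smul hb), (h2.smul ha).add (h2'.smul hb), ?_, ?_⟩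
    · simp only [Prod.smul_mk, Prod.mk_add_mk, smul_eq_mul]
      positivity
    · simp only [Prod.smul_mk, Prod.mk_add_mk, smul_eq_mul, trace_add, trace_smul]
      linear_combination a * h4 + b * h4' + hab
  have hlin : IsLinearMap ℝ Λ := by
    constructor
    · rintro ⟨Z, Y, s⟩ ⟨Z', Y', s'⟩
      simp only [hΛ, Prod.mk_add_mk, Matrix.mul_add, Matrix.add_mul, trace_add, add_smul]
      refine Prod.ext ?_ ?_ <;> simp only <;> abel
    · rintro c ⟨Z, Y, s⟩
      simp only [hΛ, Prod.smul_mk, Matrix.mul_smul, Matrix.smul_mul, trace_smul, smul_add,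
        smul_eq_mul, mul_smul, mul_add]
  have hΛc : Continuous Λ := by fun_prop
  by_cases hdisj : Disjoint (Λ '' Ω) ({0} ×ˢ Set.Iic 0)
  · exfalso
    obtain ⟨f, u, v, hfu, huv, hfv⟩ := geometric_hahn_banach_compact_closed
      (hconv.is_linear_image hlin) (hcpt.image hΛc)
      ((convex_singleton 0).prod (convex_Iic 0)) (isClosed_singleton.prod isClosed_Iic) hdisj
    have hv0 : v < 0 := by
      have := hfv (0, 0) ⟨rfl, le_refl (0 : ℝ)⟩
      rwa [Prod.mk_zero_zero, map_zero] at this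
    obtain ⟨D₀, hD₀⟩ := exists_trace_repr (f.toLinearMap ∘ₗ LinearMap.inl ℝ (Matrix ι ι ℝ) ℝ)
    set τ := -f (0, 1) with hτd
    have hfr : ∀ r : ℝ, f (0, r) = -(τ * r) := fun r => by
      have : ((0, r) : Matrix ι ι ℝ × ℝ) = r • (0, 1) := by simp
      rw [this, map_smul, smul_eq_mul, hτd]
      ring
    have hf : ∀ M r, f (M, r) = (D₀ * M).trace - τ * r := fun M r => by
      have : ((M, r) : Matrix ι ι ℝ × ℝ) = (M, 0) + (0, r) := by simp
      rw [this, map_add, hfr, ← hD₀]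
      simp [sub_eq_add_neg]
    have hτ : 0 ≤ τ := by
      by_contra! h
      have h1 := hfv (0, v / (-τ)) ⟨rfl, (div_neg_of_neg_of_pos hv0 (by linarith)).le⟩
      have h2 : -(τ * (v / (-τ))) = v := by
        rw [← neg_mul, mul_div_cancel₀ _ (neg_ne_zero.2 h.ne)]
      rw [hfr, h2] at h1
      exact lt_irrefl _ h1
    set D : Matrix ι ι ℝ := -((1 / 2 : ℝ) • (D₀ + D₀ᵀ)) with hD
    have hDs : Dᵀ = D := by simp [hD, add_comm]
    have hDtr : ∀ M : Matrix ι ι ℝ, Mᵀ = M → (D₀ * M).trace = -(D * M).trace := fun M hM => by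
      have h1 : (D₀ᵀ * M).trace = (D₀ * M).trace := by
        rw [← trace_transpose, transpose_mul, hM, transpose_transpose, trace_mul_comm]
      simp only [hD, Matrix.neg_mul, trace_neg, smul_mul, trace_smul, Matrix.add_mul, trace_add,
        h1, smul_eq_mul]
      ring
    have hpos : ∀ Z : Matrix σ σ ℝ, ∀ Y : Matrix ι ι ℝ, ∀ s : ℝ, Z.PosSemidef → Y.PosSemidef →
        0 ≤ s → Z.trace + Y.trace + s = 1 →
        0 < (Z * (Jᵀ * D * E + Eᵀ * D * J + τ • F)).trace + (Y * (D + τ • P)).trace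
          + s * D.trace := by
      intro Z Y s hZ hY hs ht
      have hZs := (posSemidef_real_iff.1 hZ).1
      have hYs := (posSemidef_real_iff.1 hY).1
      have h1 := hfu _ (Set.mem_image_of_mem Λ (show (Z, Y, s) ∈ Ω from ⟨hZ, hY, hs, ht⟩))
      simp only [hΛ] at h1
      rw [hf, hDtr _ (by simp [hZs, hYs, Matrix.mul_assoc, add_comm])] at h1
      rw [Matrix.mul_add Z, trace_add, trace_mul_lyapunov, Matrix.mul_add Y, trace_add,
        trace_mul_comm Y D]
      simp only [Matrix.mul_add, trace_add, Matrix.mul_smul, trace_smul, smul_eq_mul,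
        Matrix.mul_one, trace_mul_comm Y P] at h1 ⊢
      linarith
    have hDtrace : 0 < D.trace := by
      simpa using hpos 0 0 1 PosSemidef.zero PosSemidef.zero zero_le_one (by simp)
    have hFs := (posSemidef_real_iff.1 hF).1
    have hDP : (D + τ • P).PosSemidef := by
      refine posSemidef_of_trace_nonneg (by simp [hDs, hPs]) fun Y hY ht => ?_
      simpa using (hpos 0 Y 0 PosSemidef.zero hY le_rfl (by simp [ht])).le
    have hDF : (Jᵀ * D * E + Eᵀ * D * J + τ • F).PosSemidef := by
      refine posSemidef_of_trace_nonneg ?_ fun Z hZ ht => ?_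
      · rw [transpose_add, transpose_smul, hFs]
        simp [hDs, Matrix.mul_assoc, add_comm]
      · simpa using (hpos Z 0 0 hZ PosSemidef.zero le_rfl (by simp [ht])).le
    have hc : 0 < (τ + 1)⁻¹ := by positivity
    have h1 := hmax ((τ + 1)⁻¹ • D + P) (by
      rw [← inv_add_one_smul_add hτ]
      exact (hDP.add hP).smul hc.le) (by
      have h2 := (hDF.add hF).smul hc.le
      rw [inv_add_one_smul_add hτ, hFd] at h2
      convert h2 using 1
      simp only [Matrix.mul_add, Matrix.add_mul, Matrix.mul_smul, Matrix.smul_mul, smul_add]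
      abel)
    rw [trace_add, trace_smul, smul_eq_mul] at h1
    have : 0 < (τ + 1)⁻¹ * D.trace := by positivity
    linarith
  · obtain ⟨_, ⟨⟨Z, Y, s⟩, ⟨hZ, hY, hs, ht⟩, rfl⟩, h0, hle⟩ := Set.not_disjoint_iff.1 hdisj
    simp only [hΛ, Set.mem_singleton_iff, Set.mem_Iic] at hZ hY hs ht h0 hle
    have h1 := trace_mul_nonneg hZ hF
    have h2 := trace_mul_nonneg hP hY
    have hs0 : 0 < s := by
      refine lt_of_le_of_ne hs fun h => ?_
      subst h
      rw [zero_smul, add_zero] at h0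
      have h3 := congrArg (fun M => (P * M).trace) h0
      simp only [Matrix.mul_add P _ Y, trace_add, ← trace_mul_lyapunov, Matrix.mul_zero,
        trace_zero] at h3
      have h4 : (Z * F).trace = (Z * (Jᵀ * P * E + Eᵀ * P * J)).trace + (Z * G).trace := by
        rw [hFd, Matrix.mul_add, trace_add]
      have h5 := trace_mul_nonneg hZ hG
      have hZ0 := hinj Z Y hZ hY h0 (by linarith)
      subst hZ0
      have hY0 : Y = 0 := by simpa using h0
      subst hY0
      simp at ht
    refine ⟨s⁻¹ • Z, s⁻¹ • Y, hZ.smul (by positivity), hY.smul (by positivity), ?_, ?_⟩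
    · have := congrArg (s⁻¹ • ·) h0
      simpa [smul_add, smul_smul, hs0.ne'] using this
    · rw [smul_mul, trace_smul, le_antisymm (by linarith) h1, smul_zero]

end Duality

section Existence

variable {ι κ ο : Type*} [Fintype ι] [DecidableEq ι]

theorem lyapunov_fromCols (A D : Matrix ι ι ℝ) (B : Matrix ι κ ℝ) :
    (fromCols A B)ᵀ * D * fromCols (1 : Matrix ι ι ℝ) (0 : Matrix ι κ ℝ) +
      (fromCols (1 : Matrix ι ι ℝ) (0 : Matrix ι κ ℝ))ᵀ * D * fromCols A B =
    fromBlocks (Aᵀ * D + D * A) (D * B) (Bᵀ * D) 0 := by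
  rw [transpose_fromCols, transpose_fromCols, fromRows_mul _ _ D, fromRows_mul _ _ D, fromRows_mul_fromCols,
    fromRows_mul_fromCols, fromBlocks_add]
  simp

variable [Fintype κ] [Fintype ο] [DecidableEq κ]

theorem riccati_exists {A : Matrix ι ι ℝ} {B : Matrix ι κ ℝ} {C : Matrix ο ι ℝ}
    {R : Matrix κ κ ℝ} {N : ℕ} (hR : R.PosDef)
    (hc : ∀ v : ι → ℝ, (∀ k < N, Bᵀ *ᵥ ((Aᵀ ^ k) *ᵥ v) = 0) → v = 0)
    (ho : ∀ v : ι → ℝ, (∀ k < N, C *ᵥ ((A ^ k) *ᵥ v) = 0) → v = 0) :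
    ∃ P : Matrix ι ι ℝ, P.PosSemidef ∧
      Aᵀ * P + P * A - P * B * R⁻¹ * Bᵀ * P + Cᵀ * C = 0 := by
  set J : Matrix ι (ι ⊕ κ) ℝ := fromCols A B with hJ
  set E : Matrix ι (ι ⊕ κ) ℝ := fromCols 1 0 with hE
  set G : Matrix (ι ⊕ κ) (ι ⊕ κ) ℝ := fromBlocks (Cᵀ * C) 0 0 R with hGd
  have hRs := (posSemidef_real_iff.1 hR.posSemidef).1
  have hRu : IsUnit R.det := (isUnit_iff_isUnit_det R).1 hR.isUnit
  have hG : G.PosSemidef := by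
    refine posSemidef_real_iff.2 ⟨by simp [hGd, fromBlocks_transpose, hRs], fun x => ?_⟩
    have h1 := (posSemidef_real_iff.1 hR.posSemidef).2 (x ∘ Sum.inr)
    have h2 : 0 ≤ (x ∘ Sum.inl) ⬝ᵥ (Cᵀ * C) *ᵥ (x ∘ Sum.inl) :=
      (posSemidef_real_iff.1 (by simpa using posSemidef_conjTranspose_mul_self C)).2 _
    rw [hGd, fromBlocks_mulVec]
    simp only [zero_mulVec, add_zero, zero_add, dotProduct, Fintype.sum_sum_type, Sum.elim_inl,
      Sum.elim_inr]
    exact add_nonneg h2 h1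
  obtain ⟨P, hP, hF, hmax⟩ := exists_max_trace (J := J) (E := E) (fun D hD hDF => by
    rw [lyapunov_fromCols] at hDF
    refine eq_zero_of_lyapunov_of_controllable hc (posSemidef_real_iff.1 hD).1 ?_
      (hDF.submatrix Sum.inl)
    ext i j
    have h1 := posSemidef_mulVec_eq_zero hDF (x := Pi.single (Sum.inr j) 1) (by simp)
    simpa using congrFun h1 (Sum.inl i)) hG
  obtain ⟨Z, Y, hZ, hY, heq, htr⟩ := exists_multiplier (fun Z Y hZ hY heq htr => by
    have hZG := mul_eq_zero_of_trace_mul_eq_zero hZ hG htr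
    have hZs := (posSemidef_real_iff.1 hZ).1
    obtain ⟨Z₁, Z₂, Z₃, Z₄, rfl⟩ : ∃ Z₁ Z₂ Z₃ Z₄, Z = fromBlocks Z₁ Z₂ Z₃ Z₄ :=
      ⟨_, _, _, _, (fromBlocks_toBlocks Z).symm⟩
    simp only [hGd, fromBlocks_multiply, Matrix.mul_zero, add_zero, zero_add, ← fromBlocks_zero,
      fromBlocks_inj] at hZG
    simp only [fromBlocks_transpose, fromBlocks_inj] at hZs
    obtain rfl : Z₂ = 0 := by
      rw [← mul_nonsing_inv_cancel_right R Z₂ hRu, hZG.2.1, Matrix.zero_mul]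
    obtain rfl : Z₄ = 0 := by
      rw [← mul_nonsing_inv_cancel_right R Z₄ hRu, hZG.2.2.2, Matrix.zero_mul]
    obtain rfl : Z₃ = 0 := by simpa using hZs.2.2.1.symm
    have hCZ : Z₁ * Cᵀ = 0 := by
      have h1 : (Z₁ * Cᵀ) * (Z₁ * Cᵀ)ᴴ = 0 := by
        have : (Z₁ * Cᵀ) * (Z₁ * Cᵀ)ᴴ = Z₁ * (Cᵀ * C) * Z₁ᵀ := by simp [Matrix.mul_assoc]
        rw [this, hZG.1, Matrix.zero_mul]
      exact self_mul_conjTranspose_eq_zero.1 h1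
    have hZ₁ : Z₁ = 0 := by
      refine eq_zero_of_lyapunov_of_controllable (A := -Aᵀ) (B := Cᵀ) (N := N)
        (fun v hv => ho v fun k hk => ?_) hZs.1 hCZ ?_
      · have h1 := hv k hk
        rw [transpose_neg, transpose_transpose, transpose_transpose, neg_pow] at h1
        rcases neg_one_pow_eq_or (Matrix ι ι ℝ) k with h2 | h2 <;>
          simpa [h2, neg_mulVec, mulVec_neg] using h1
      · have h1 : (-Aᵀ)ᵀ * Z₁ + Z₁ * -Aᵀ = Y := by
          simp only [hJ, hE, fromCols_mul_fromBlocks, transpose_fromCols,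
            fromCols_mul_fromRows] at heq
          simp at heq
          rw [← sub_eq_zero, ← neg_eq_zero, ← heq]
          simp
          abel
        rw [h1]
        exact hY
    rw [hZ₁, fromBlocks_zero]) hG hP hF hmax
  refine ⟨P, hP, ?_⟩
  have hPs := (posSemidef_real_iff.1 hP).1
  have hFZ := mul_eq_zero_of_trace_mul_eq_zero hF hZ (by rw [trace_mul_comm]; exact htr)
  set X := Aᵀ * P + P * A - P * B * R⁻¹ * Bᵀ * P + Cᵀ * C with hX
  have hTF : (fromCols 1 (-(P * B * R⁻¹)) : Matrix ι (ι ⊕ κ) ℝ) * (Jᵀ * P * E + Eᵀ * P * J + G) = X * E := by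
    rw [lyapunov_fromCols, hGd, fromBlocks_add, fromCols_mul_fromBlocks, hE, mul_fromCols]
    congr 1
    · simp only [hX, add_zero, Matrix.one_mul, Matrix.mul_one, Matrix.neg_mul, Matrix.mul_assoc]
      abel
    · simp [Matrix.mul_assoc, nonsing_inv_mul _ hRu]
  have hXZ : X * (E * Z * Eᵀ) = 0 := by
    rw [← Matrix.mul_assoc, ← Matrix.mul_assoc, ← hTF, Matrix.mul_assoc _ _ Z, hFZ]
    simp
  have hW : (E * Z * Eᵀ).PosDef := by
    have hps : (E * Z * Eᵀ).PosSemidef := by simpa using hZ.mul_mul_conjTranspose_same E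
    refine PosDef.of_dotProduct_mulVec_pos hps.1 fun {w} hw => ?_
    rw [star_trivial]
    refine lt_of_le_of_ne ((posSemidef_real_iff.1 hps).2 w) fun h0 => hw ?_
    have hZE : Z *ᵥ (Eᵀ *ᵥ w) = 0 := posSemidef_mulVec_eq_zero hZ (by
      rw [h0, ← mulVec_mulVec, ← mulVec_mulVec, dotProduct_mulVec w E, ← mulVec_transpose])
    have hZE' : (w ᵥ* E) ᵥ* Z = 0 := by
      rw [← mulVec_transpose E, ← (posSemidef_real_iff.1 hZ).1, vecMul_transpose, hZE]
    have h1 := congrArg (fun M => w ⬝ᵥ M *ᵥ w) heq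
    simp only [add_mulVec, ← mulVec_mulVec, hZE, mulVec_zero, zero_add, dotProduct_add,
      dotProduct_mulVec w E, dotProduct_mulVec (w ᵥ* E) Z, hZE', zero_dotProduct, one_mulVec,
      zero_mulVec, dotProduct_zero] at h1
    have h2 := (posSemidef_real_iff.1 hY).2 w
    have h3 : 0 ≤ w ⬝ᵥ w := by simpa using dotProduct_star_self_nonneg w
    exact dotProduct_self_eq_zero.1 (by linarith)
  rw [← mul_nonsing_inv_cancel_right (E * Z * Eᵀ) X ((isUnit_iff_isUnit_det _).1 hW.isUnit), hXZ,
    Matrix.zero_mul]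

end Existence

/-- If `(A,B)` is controllable and `(A,C)` observable, the continuous-time
algebraic Riccati equation has a unique positive definite solution. -/
theorem care_exists_unique
    {n m p : ℕ} (A : Matrix (Fin n) (Fin n) ℝ) (B : Matrix (Fin n) (Fin m) ℝ)
    (C : Matrix (Fin p) (Fin n) ℝ) (R : Matrix (Fin m) (Fin m) ℝ)
    (hR : R.PosDef)
    (hCtrb : ∀ v : Fin n → ℝ, (∀ k < n, Bᵀ *ᵥ ((Aᵀ ^ k) *ᵥ v) = 0) → v = 0)
    (hObs : ∀ v : Fin n → ℝ, (∀ k < n, C *ᵥ ((A ^ k) *ᵥ v) = 0) → v = 0) :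
    ∃! P : Matrix (Fin n) (Fin n) ℝ, P.PosDef ∧
      Aᵀ * P + P * A - P * B * R⁻¹ * Bᵀ * P + Cᵀ * C = 0 := by
  have hS : (B * R⁻¹ * Bᵀ).PosSemidef := by
    simpa using hR.inv.posSemidef.mul_mul_conjTranspose_same B
  have hassoc : ∀ P : Matrix (Fin n) (Fin n) ℝ,
      P * B * R⁻¹ * Bᵀ * P = P * (B * R⁻¹ * Bᵀ) * P := fun P => by
    simp only [Matrix.mul_assoc]
  obtain ⟨P, hP, h⟩ := riccati_exists hR hCtrb hObs
  simp only [hassoc] at h ⊢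
  have hPd := riccati_posDef hObs hP h
  exact ⟨P, ⟨hPd, h⟩, fun P' h' => riccati_unique hS hObs h'.1 hPd h'.2 h⟩
end
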